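/- arXiv:1110.0042 — 3 statements merged into one kernel-verified Lean document; each statement's English description precedes it below -/
import Mathlib

section
/- There exists a constant C > 0, depending only on ξ, such that for all x, v ∈ ℝ³ and all real t₁ ≤ t₂, if x + s v belongs to the closure of Ω for every s ∈ [t₁, t₂], then e^{C(|v|+1)t₁} α(t₁) ≤ e^{C(|v|+1)t₂} α(t₂) and e^{−C(|v|+1)t₁} α(t₁) ≥ e^{−C(|v|+1)t₂} α(t₂). -/
open Real
open scoped RealInnerProductSpace

/-- The functional `α(s)` along the straight-line trajectory `X(s) = x + s v`:
`α(s) = ξ(X(s))² + (v·∇ξ(X(s)))² − 2 (v·∇²ξ(X(s)) v) ξ(X(s))`. -/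
noncomputable def alphaFun (ξ : EuclideanSpace ℝ (Fin 3) → ℝ)
    (x v : EuclideanSpace ℝ (Fin 3)) (s : ℝ) : ℝ :=
  (ξ (x + s • v)) ^ 2 + (⟪gradient ξ (x + s • v), v⟫) ^ 2
    - 2 * (fderiv ℝ (fderiv ℝ ξ) (x + s • v) v v) * ξ (x + s • v)

/-- Grönwall-type monotonicity: if `|f'| ≤ K f` on `[a, b]`, then `e^{Ks} f(s)` does not decrease and
`e^{-Ks} f(s)` does not increase from `a` to `b`. -/
theorem exp_mul_le_of_abs_deriv_le {f f' : ℝ → ℝ} {K a b : ℝ} (hab : a ≤ b)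
    (hf : ∀ s, HasDerivAt f (f' s) s) (hK : ∀ s ∈ Set.Icc a b, |f' s| ≤ K * f s) :
    exp (K * a) * f a ≤ exp (K * b) * f b ∧ exp (-K * b) * f b ≤ exp (-K * a) * f a := by
  have hd (k s : ℝ) : HasDerivAt (fun s => exp (k * s) * f s)
      (exp (k * s) * (k * f s + f' s)) s := by
    have he : HasDerivAt (fun s => exp (k * s)) (exp (k * s) * k) s := by
      simpa using ((hasDerivAt_id s).const_mul k).exp
    exact (he.mul (hf s)).congr_deriv (by ring)
  have hc (k : ℝ) : ContinuousOn (fun s => exp (k * s) * f s) (Set.Icc a b) :=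
    fun s _ => (hd k s).continuousAt.continuousWithinAt
  constructor
  · refine monotoneOn_of_hasDerivWithinAt_nonneg (convex_Icc a b) (hc K)
      (fun s _ => (hd K s).hasDerivWithinAt) (fun s hs => ?_)
      (Set.left_mem_Icc.2 hab) (Set.right_mem_Icc.2 hab) hab
    have := (abs_le.1 (hK s (interior_subset hs))).1
    exact mul_nonneg (exp_pos _).le (by linarith)
  · refine antitoneOn_of_hasDerivWithinAt_nonpos (convex_Icc a b) (hc (-K))
      (fun s _ => (hd (-K) s).hasDerivWithinAt) (fun s hs => ?_)
      (Set.left_mem_Icc.2 hab) (Set.right_mem_Icc.2 hab) hab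
    have := (abs_le.1 (hK s (interior_subset hs))).2
    exact mul_nonpos_of_nonneg_of_nonpos (exp_pos _).le (by linarith)

section Line

set_option maxSynthPendingDepth 3

variable {E : Type*} [NormedAddCommGroup E] [NormedSpace ℝ E] {ξ : E → ℝ}

theorem hasDerivAt_comp_line {G : Type*} [NormedAddCommGroup G] [NormedSpace ℝ G] {F : E → G}
    (hF : Differentiable ℝ F) (x v : E) (s : ℝ) :
    HasDerivAt (fun s : ℝ => F (x + s • v)) (fderiv ℝ F (x + s • v) v) s := by
  have hX : HasDerivAt (fun s : ℝ => x + s • v) v s := by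
    simpa using ((hasDerivAt_id s).smul_const v).const_add x
  exact (hF (x + s • v)).hasFDerivAt.comp_hasDerivAt s hX

/-- The terms containing the second derivative of `ξ` along the line cancel in `α'`. -/
theorem hasDerivAt_alpha_line (hξ : ContDiff ℝ 3 ξ) (x v : E) (s : ℝ) :
    HasDerivAt (fun s : ℝ => ξ (x + s • v) ^ 2 + (fderiv ℝ ξ (x + s • v) v) ^ 2
        - 2 * (fderiv ℝ (fderiv ℝ ξ) (x + s • v) v v) * ξ (x + s • v))
      (2 * ξ (x + s • v) * fderiv ℝ ξ (x + s • v) v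
        - 2 * fderiv ℝ (fderiv ℝ (fderiv ℝ ξ)) (x + s • v) v v v * ξ (x + s • v)) s := by
  have hξ₁ : ContDiff ℝ 2 (fderiv ℝ ξ) := hξ.fderiv_right (by norm_num)
  have hξ₂ : ContDiff ℝ 1 (fderiv ℝ (fderiv ℝ ξ)) := hξ₁.fderiv_right (by norm_num)
  have h₀ := hasDerivAt_comp_line (hξ.differentiable (by norm_num)) x v s
  have h₁ : HasDerivAt (fun s : ℝ => fderiv ℝ ξ (x + s • v) v)
      (fderiv ℝ (fderiv ℝ ξ) (x + s • v) v v) s :=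
    ((hasDerivAt_comp_line (hξ₁.differentiable (by norm_num)) x v s).clm_apply
      (hasDerivAt_const s v)).congr_deriv (by simp)
  have h₂ : HasDerivAt (fun s : ℝ => fderiv ℝ (fderiv ℝ ξ) (x + s • v) v)
      (fderiv ℝ (fderiv ℝ (fderiv ℝ ξ)) (x + s • v) v v) s :=
    ((hasDerivAt_comp_line (hξ₂.differentiable (by norm_num)) x v s).clm_apply
      (hasDerivAt_const s v)).congr_deriv (by simp)
  have h₃ : HasDerivAt (fun s : ℝ => fderiv ℝ (fderiv ℝ ξ) (x + s • v) v v)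
      (fderiv ℝ (fderiv ℝ (fderiv ℝ ξ)) (x + s • v) v v v) s :=
    (h₂.clm_apply (hasDerivAt_const s v)).congr_deriv (by simp)
  exact (((h₀.pow 2).add (h₁.pow 2)).sub ((h₃.const_mul 2).mul h₀)).congr_deriv (by
    simp only [Nat.cast_ofNat, Nat.add_one_sub_one, pow_one]
    ring)

theorem exists_abs_third_fderiv_le (hξ : ContDiff ℝ 3 ξ) {K : Set E} (hK : IsCompact K) :
    ∃ M : ℝ, 0 ≤ M ∧ ∀ x ∈ K, ∀ v : E,
      |fderiv ℝ (fderiv ℝ (fderiv ℝ ξ)) x v v v| ≤ M * ‖v‖ ^ 3 := by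
  have hξ₁ : ContDiff ℝ 2 (fderiv ℝ ξ) := hξ.fderiv_right (by norm_num)
  have hξ₂ : ContDiff ℝ 1 (fderiv ℝ (fderiv ℝ ξ)) := hξ₁.fderiv_right (by norm_num)
  obtain ⟨M, hM⟩ := hK.exists_bound_of_continuousOn
    (hξ₂.continuous_fderiv (by norm_num)).continuousOn
  refine ⟨max M 0, le_max_right _ _, fun x hx v => ?_⟩
  set T := fderiv ℝ (fderiv ℝ (fderiv ℝ ξ)) x
  have hT : ‖T‖ ≤ max M 0 := (hM x hx).trans (le_max_left _ _)
  calc |T v v v| ≤ ‖T v‖ * ‖v‖ * ‖v‖ := (T v).le_opNorm₂ v v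
    _ ≤ ‖T‖ * ‖v‖ * ‖v‖ * ‖v‖ := by gcongr; exact T.le_opNorm v
    _ ≤ max M 0 * ‖v‖ * ‖v‖ * ‖v‖ := by gcongr
    _ = max M 0 * ‖v‖ ^ 3 := by ring

end Line

/-- The pointwise bound on `α'`, with `g`, `g₁`, `g₂`, `g₃` standing for `ξ` and its first three
derivatives along a line of velocity of norm `r`. -/
theorem abs_alpha_deriv_le {g g₁ g₂ g₃ r c M : ℝ} (hg : g ≤ 0) (hr : 0 ≤ r) (hc : 0 < c)
    (hM : 0 ≤ M) (h₂ : c * r ^ 2 ≤ g₂) (h₃ : |g₃| ≤ M * r ^ 3) :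
    |2 * g * g₁ - 2 * g₃ * g| ≤ (1 + M / c) * (r + 1) * (g ^ 2 + g₁ ^ 2 - 2 * g₂ * g) := by
  have hA : |2 * g * g₁| ≤ g ^ 2 + g₁ ^ 2 :=
    abs_le.2 ⟨by nlinarith [sq_nonneg (g + g₁)], by nlinarith [sq_nonneg (g - g₁)]⟩
  have hB : |2 * g₃ * g| ≤ M / c * r * (-2 * g₂ * g) := by
    have h : M * r ^ 3 ≤ M / c * r * g₂ :=
      calc M * r ^ 3 = M / c * r * (c * r ^ 2) := by field_simp
        _ ≤ M / c * r * g₂ := by gcongr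
    rw [abs_mul, abs_mul, abs_two, abs_of_nonpos hg]
    nlinarith [mul_le_mul_of_nonneg_right (h₃.trans h) (neg_nonneg.2 hg)]
  have hP : 0 ≤ g ^ 2 + g₁ ^ 2 := by positivity
  have hQ : 0 ≤ -2 * g₂ * g := by
    have : 0 ≤ g₂ := le_trans (by positivity) h₂
    nlinarith [mul_nonneg this (neg_nonneg.2 hg)]
  have hk : 0 ≤ M / c := by positivity
  have h := abs_sub (2 * g * g₁) (2 * g₃ * g)
  have hcoef₁ : 1 ≤ (1 + M / c) * (r + 1) := by nlinarith [mul_nonneg hk hr]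
  have hcoef₂ : M / c * r ≤ (1 + M / c) * (r + 1) := by nlinarith
  nlinarith [mul_le_mul_of_nonneg_right hcoef₁ hP, mul_le_mul_of_nonneg_right hcoef₂ hQ]

theorem velocity_lemma (ξ : EuclideanSpace ℝ (Fin 3) → ℝ)
    (hsmooth : ContDiff ℝ 3 ξ)
    (hbdd : Bornology.IsBounded {x : EuclideanSpace ℝ (Fin 3) | ξ x < 0})
    (hgrad : ∀ x, ξ x = 0 → gradient ξ x ≠ 0)
    (hconv : ∃ Cξ > (0 : ℝ), ∀ x, ξ x ≤ 0 → ∀ ζ : EuclideanSpace ℝ (Fin 3),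
        Cξ * ‖ζ‖ ^ 2 ≤ fderiv ℝ (fderiv ℝ ξ) x ζ ζ) :
    ∃ C > (0 : ℝ), ∀ (x v : EuclideanSpace ℝ (Fin 3)) (t₁ t₂ : ℝ), t₁ ≤ t₂ →
      (∀ s ∈ Set.Icc t₁ t₂, x + s • v ∈ closure {y : EuclideanSpace ℝ (Fin 3) | ξ y < 0}) →
      Real.exp (C * (‖v‖ + 1) * t₁) * alphaFun ξ x v t₁
          ≤ Real.exp (C * (‖v‖ + 1) * t₂) * alphaFun ξ x v t₂ ∧
        Real.exp (-C * (‖v‖ + 1) * t₂) * alphaFun ξ x v t₂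
          ≤ Real.exp (-C * (‖v‖ + 1) * t₁) * alphaFun ξ x v t₁ := by
  obtain ⟨c, hc, hconv⟩ := hconv
  obtain ⟨M, hM, h₃⟩ := exists_abs_third_fderiv_le hsmooth hbdd.isCompact_closure
  refine ⟨1 + M / c, by positivity, fun x v t₁ t₂ ht hs => ?_⟩
  have hα : alphaFun ξ x v = fun s => ξ (x + s • v) ^ 2 + (fderiv ℝ ξ (x + s • v) v) ^ 2
      - 2 * (fderiv ℝ (fderiv ℝ ξ) (x + s • v) v v) * ξ (x + s • v) := by
    funext s
    simp only [alphaFun, gradient, InnerProductSpace.toDual_symm_apply]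
  rw [neg_mul, hα]
  refine exp_mul_le_of_abs_deriv_le ht (hasDerivAt_alpha_line hsmooth x v) fun s hst => ?_
  have hg : ξ (x + s • v) ≤ 0 :=
    closure_minimal (fun y hy => le_of_lt hy)
      (isClosed_le hsmooth.continuous continuous_const) (hs s hst)
  exact abs_alpha_deriv_le hg (norm_nonneg v) hc hM (hconv _ hg v) (h₃ _ (hs s hst) v)
end

section
/- For every c > 0 there exists a constant C > 0 such that for every u ∈ ℝ³ with |u| ≥ 1, ∫_{ℝ³} (1 + |η|^{−1}) e^{−c|η|²} e^{−c|u·η|} dη ≤ C / |u|. -/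
open Real MeasureTheory
open scoped RealInnerProductSpace

lemma integrable_comp_abs_of_integrableOn_Ioi {f : ℝ → ℝ}
    (hf : IntegrableOn f (Set.Ioi 0)) : Integrable fun x : ℝ ↦ f |x| := by
  have h := integrable_fun_norm_addHaar (E := ℝ) (F := ℝ) volume (f := f)
  simpa using h.2 (by simpa using hf)

lemma integrable_exp_neg_mul_abs {a : ℝ} (ha : 0 < a) :
    Integrable fun x : ℝ ↦ exp (-a * |x|) :=
  integrable_comp_abs_of_integrableOn_Ioi (integrableOn_exp_mul_Ioi (neg_neg_of_pos ha) 0)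

lemma integral_exp_neg_mul_abs {a : ℝ} (ha : 0 < a) :
    ∫ x : ℝ, exp (-a * |x|) = 2 / a := by
  rw [integral_comp_abs (f := fun x ↦ exp (-a * x)), integral_exp_mul_Ioi (neg_neg_of_pos ha)]
  simp [div_eq_mul_inv]

lemma integrable_one_add_abs_rpow_mul_exp_neg_mul_sq {c s : ℝ} (hc : 0 < c) (hs : -1 < s) :
    Integrable fun x : ℝ ↦ (1 + |x| ^ s) * exp (-c * x ^ 2) := by
  have h := integrable_comp_abs_of_integrableOn_Ioi (integrableOn_rpow_mul_exp_neg_mul_sq hc hs)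
  simp only [sq_abs] at h
  simpa only [add_mul, one_mul] using! (integrable_exp_neg_mul_sq hc).add h

lemma inv_le_abs_rpow_mul_abs_rpow {r y z : ℝ} (hr : 0 ≤ r) (hy : y ≠ 0) (hz : z ≠ 0)
    (h : y ^ 2 + z ^ 2 ≤ r ^ 2) :
    r⁻¹ ≤ |y| ^ (-(1 / 2) : ℝ) * |z| ^ (-(1 / 2) : ℝ) := by
  have hyz : |y| * |z| ≤ r ^ 2 := by
    nlinarith [sq_nonneg (|y| - |z|), sq_abs y, sq_abs z, sq_nonneg y, sq_nonneg z]
  rw [← mul_rpow (abs_nonneg y) (abs_nonneg z)]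
  calc r⁻¹ = (r ^ 2) ^ (-(1 / 2) : ℝ) := by
        rw [rpow_neg (sq_nonneg r), ← sqrt_eq_rpow, sqrt_sq hr]
    _ ≤ _ := rpow_le_rpow_of_nonpos (by positivity) hyz (by norm_num)

lemma one_add_inv_mul_exp_neg_mul_sq_le {c r y z : ℝ} (hc : 0 < c) (hr : 0 ≤ r)
    (hy : y ≠ 0) (hz : z ≠ 0) (h : y ^ 2 + z ^ 2 ≤ r ^ 2) :
    (1 + r⁻¹) * exp (-c * r ^ 2) ≤
      ((1 + |y| ^ (-(1 / 2) : ℝ)) * exp (-c * y ^ 2)) *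
        ((1 + |z| ^ (-(1 / 2) : ℝ)) * exp (-c * z ^ 2)) := by
  have h_inv := inv_le_abs_rpow_mul_abs_rpow hr hy hz h
  have h_exp : exp (-c * r ^ 2) ≤ exp (-c * y ^ 2) * exp (-c * z ^ 2) := by
    rw [← exp_add]
    gcongr
    nlinarith
  have hy' : 0 ≤ |y| ^ (-(1 / 2) : ℝ) := by positivity
  have hz' : 0 ≤ |z| ^ (-(1 / 2) : ℝ) := by positivity
  calc (1 + r⁻¹) * exp (-c * r ^ 2)
      ≤ ((1 + |y| ^ (-(1 / 2) : ℝ)) * (1 + |z| ^ (-(1 / 2) : ℝ))) *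
          (exp (-c * y ^ 2) * exp (-c * z ^ 2)) := by
        gcongr
        nlinarith
    _ = _ := by ring

lemma exists_orthonormalBasis_inner_eq {u : EuclideanSpace ℝ (Fin 3)} (hu : u ≠ 0) :
    ∃ b : OrthonormalBasis (Fin 3) ℝ (EuclideanSpace ℝ (Fin 3)),
      ∀ η, ⟪u, η⟫ = ‖u‖ * b.repr η 0 := by
  have hv : Orthonormal ℝ
      (({0} : Set (Fin 3)).domRestrict fun _ ↦ ‖u‖⁻¹ • u) := by
    refine ⟨fun i ↦ ?_, fun i j hij ↦ (hij (Subsingleton.elim i j)).elim⟩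
    simp [norm_smul, hu]
  obtain ⟨b, hb⟩ := hv.exists_orthonormalBasis_extension_of_card_eq (by simp)
  refine ⟨b, fun η ↦ ?_⟩
  rw [b.repr_apply_apply, hb 0 rfl, real_inner_smul_left, mul_inv_cancel_left₀ (by simpa using hu)]

theorem integral_gaussian_times_directional_decay (c : ℝ) (hc : 0 < c) :
    ∃ C > (0 : ℝ), ∀ u : EuclideanSpace ℝ (Fin 3), 1 ≤ ‖u‖ →
      ∫⁻ η : EuclideanSpace ℝ (Fin 3),
          ENNReal.ofReal
            ((1 + ‖η‖⁻¹) * Real.exp (-c * ‖η‖ ^ 2) * Real.exp (-c * |⟪u, η⟫|))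
        ≤ ENNReal.ofReal (C / ‖u‖) := by
  set g : ℝ → ℝ := fun x ↦ (1 + |x| ^ (-(1 / 2) : ℝ)) * exp (-c * x ^ 2)
  have g_int : Integrable g :=
    integrable_one_add_abs_rpow_mul_exp_neg_mul_sq hc (by norm_num)
  have g_pos : 0 ≤ ∫ x, g x := integral_nonneg fun x ↦ by positivity
  refine ⟨2 / c * (∫ x, g x) ^ 2 + 1, by positivity, fun u hu ↦ ?_⟩
  have hu_pos : 0 < ‖u‖ := one_pos.trans_le hu
  obtain ⟨b, hb⟩ := exists_orthonormalBasis_inner_eq (norm_pos_iff.1 hu_pos)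
  let f : Fin 3 → ℝ → ℝ := ![fun x ↦ exp (-(c * ‖u‖) * |x|), g, g]
  have f_int : ∀ i, Integrable (f i) := by
    intro i
    fin_cases i
    exacts [integrable_exp_neg_mul_abs (by positivity), g_int, g_int]
  have f_nonneg : ∀ i x, 0 ≤ f i x := by
    intro i x
    fin_cases i
    · exact (exp_pos _).le
    all_goals exact mul_nonneg (by positivity) (exp_pos _).le
  have prod_int : Integrable fun x : Fin 3 → ℝ ↦ ∏ i, f i (x i) :=
    Integrable.fintype_prod_dep f_int
  have hT : MeasurePreserving fun η ↦ (b.repr η).ofLp :=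
    (PiLp.volume_preserving_ofLp (Fin 3)).comp b.measurePreserving_repr
  have h_ne (i : Fin 3) : ∀ᵐ η, b.repr η i ≠ 0 :=
    hT.quasiMeasurePreserving.ae (Measure.ae_eval_ne _ i 0)
  calc _ ≤ ∫⁻ η, ENNReal.ofReal (∏ i, f i (b.repr η i)) := by
        refine lintegral_mono_ae ?_
        filter_upwards [h_ne 1, h_ne 2] with η h1 h2
        refine ENNReal.ofReal_le_ofReal ?_
        have h_norm : b.repr η 1 ^ 2 + b.repr η 2 ^ 2 ≤ ‖η‖ ^ 2 := by
          rw [← b.repr.norm_map η, EuclideanSpace.norm_sq_eq, Fin.sum_univ_three]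
          simp only [norm_eq_abs, sq_abs]
          linarith [sq_nonneg (b.repr η 0)]
        have h_exp : exp (-c * |⟪u, η⟫|) = f 0 (b.repr η 0) := by
          simp [f, hb, abs_mul, mul_assoc]
        rw [Fin.prod_univ_three, mul_assoc (f 0 _), mul_comm (f 0 _), h_exp]
        exact mul_le_mul_of_nonneg_right
          (one_add_inv_mul_exp_neg_mul_sq_le hc (norm_nonneg η) h1 h2 h_norm) (f_nonneg 0 _)
    _ = ∫⁻ x : Fin 3 → ℝ, ENNReal.ofReal (∏ i, f i (x i)) := by
        rw [← hT.map_eq]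
        refine (lintegral_map' (μ := volume)
          (f := fun x : Fin 3 → ℝ ↦ ENNReal.ofReal (∏ i, f i (x i))) ?_ hT.measurable.aemeasurable).symm
        rw [hT.map_eq]
        exact prod_int.aemeasurable.ennreal_ofReal
    _ = ENNReal.ofReal (2 / (c * ‖u‖) * (∫ x, g x) ^ 2) := by
        rw [← ofReal_integral_eq_lintegral_ofReal prod_int
          (ae_of_all _ fun x ↦ Finset.prod_nonneg fun i _ ↦ f_nonneg i _),
          integral_fintype_prod_volume_eq_prod, Fin.prod_univ_three,
          ← integral_exp_neg_mul_abs (mul_pos hc hu_pos), sq, ← mul_assoc]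
        rfl
    _ ≤ _ := by
        refine ENNReal.ofReal_le_ofReal ?_
        rw [le_div_iff₀ hu_pos]
        field_simp
        linarith
end

section
/- For every β ∈ ℝ there exists a constant C > 0 such that for all a, v ∈ ℝ³, ∫_{ℝ³} (|v−v′| + |v−v′|^{−1}) exp(−(1/8)|v−v′|² − (1/8)(|v−a|² − |v′−a|²)² / |v−v′|²) · (1+|v−a|²)^β (1+|v′−a|²)^{−β} dv′ ≤ C / (1 + |v−a|). -/
open Real MeasureTheory
open scoped RealInnerProductSpace

lemma weight_ratio_le (β p q m : ℝ) (hp : 0 < p) (hq : 0 < q) (hpq : p ≤ m * q)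
    (hqp : q ≤ m * p) : p ^ β * q ^ (-β) ≤ m ^ |β| := by
  rcases le_total 0 β with h | h
  · rw [abs_of_nonneg h, rpow_neg hq.le, ← div_eq_mul_inv, ← div_rpow hp.le hq.le]
    exact rpow_le_rpow (by positivity) ((div_le_iff₀ hq).2 hpq) h
  · rw [abs_of_nonpos h, ← neg_neg β, rpow_neg hp.le, neg_neg, mul_comm, ← div_eq_mul_inv,
      ← div_rpow hq.le hp.le]
    exact rpow_le_rpow (by positivity) ((div_le_iff₀ hp).2 hqp) (by linarith)

lemma one_add_rpow_le_exp {n t : ℝ} (hn : 1 ≤ n) (ht : 0 ≤ t) :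
    (1 + t) ^ n ≤ (64 * n) ^ n * exp (t / 64) := by
  have h1 : 1 + t ≤ 64 * n * exp (t / (64 * n)) := by
    have := mul_le_mul_of_nonneg_left (add_one_le_exp (t / (64 * n))) (by linarith : 0 ≤ 64 * n)
    rw [mul_add, mul_div_cancel₀ _ (by positivity)] at this
    linarith
  calc (1 + t) ^ n ≤ (64 * n * exp (t / (64 * n))) ^ n := by gcongr
    _ = _ := by
      rw [mul_rpow (by positivity) (by positivity), ← exp_mul]
      congr 2
      field_simp

lemma kernel_exponent_le {R x y z r : ℝ} (hR : 0 ≤ R) (hr : 0 < r)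
    (h : r ^ 2 = x ^ 2 + y ^ 2 + z ^ 2) :
    -(1 / 8) * r ^ 2 - (1 / 8) * ((2 * (R * x) + r ^ 2) ^ 2 / r ^ 2) + r ^ 2 / 64 ≤
      3 / 32 - (1 / 16) * |(1 + R) * x| - (1 / 16) * |y| - (1 / 16) * |z| := by
  obtain ⟨p, hp⟩ : ∃ p, R * x = p * r := ⟨R * x / r, by field_simp⟩
  have e : (2 * (R * x) + r ^ 2) ^ 2 / r ^ 2 = (2 * p + r) ^ 2 := by
    rw [hp]; field_simp
  have hx : |(1 + R) * x| = |x| + |p| * r := by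
    rw [abs_mul, abs_of_pos (by linarith : 0 < 1 + R), add_mul, one_mul]
    congr 1
    rw [← abs_of_nonneg hR, ← abs_mul, hp, abs_mul, abs_of_pos hr]
  rw [e, hx]
  nlinarith [sq_nonneg (|x| - 1), sq_nonneg (|y| - 1), sq_nonneg (|z| - 1), sq_abs x, sq_abs y,
    sq_abs z, sq_abs p, sq_nonneg (3 * p + 2 * r), sq_nonneg (4 * |p| - r), sq_nonneg p]

lemma inv_le_rpow_mul_rpow {r y z : ℝ} (hr : 0 < r) (hy : y ≠ 0) (hz : z ≠ 0)
    (h : y ^ 2 + z ^ 2 ≤ r ^ 2) :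
    r⁻¹ ≤ |y| ^ (-1 / 2 : ℝ) * |z| ^ (-1 / 2 : ℝ) := by
  have hy' := abs_pos.2 hy
  have hz' := abs_pos.2 hz
  rw [← mul_rpow hy'.le hz'.le, neg_div, rpow_neg (by positivity), ← sqrt_eq_rpow]
  refine inv_anti₀ (by positivity) (sqrt_le_iff.2 ⟨hr.le, ?_⟩)
  nlinarith [sq_nonneg (|y| - |z|), sq_abs y, sq_abs z]

lemma integrable_abs_rpow_mul_exp_neg {s : ℝ} (hs : -1 < s) :
    Integrable fun t : ℝ => |t| ^ s * exp (-(1 / 16) * |t|) := by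
  have h := (integrableOn_rpow_mul_exp_neg_mul_rpow (s := s) (p := 1) (b := 1 / 16) hs one_pos
    (by norm_num)).integrable_indicator measurableSet_Ioi
  refine (h.add h.comp_neg).congr ?_
  filter_upwards [Measure.ae_ne volume (0 : ℝ)] with t ht
  rcases lt_or_gt_of_ne ht with h0 | h0
  · simp [Set.indicator, h0, h0.le, abs_of_neg h0]
  · simp [Set.indicator, h0, h0.le, abs_of_pos h0]

lemma exists_measurePreserving_adapted_coordinates (V : EuclideanSpace ℝ (Fin 3)) :
    ∃ T : (Fin 3 → ℝ) → EuclideanSpace ℝ (Fin 3), MeasurePreserving T ∧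
      (∀ x, ‖T x‖ ^ 2 = x 0 ^ 2 + x 1 ^ 2 + x 2 ^ 2) ∧ ∀ x, ⟪V, T x⟫ = ‖V‖ * x 0 := by
  obtain ⟨e, he, hV⟩ : ∃ e : EuclideanSpace ℝ (Fin 3), ‖e‖ = 1 ∧ V = ‖V‖ • e := by
    rcases eq_or_ne V 0 with rfl | h
    · exact ⟨EuclideanSpace.single 0 1, by simp, by simp⟩
    · have h' := norm_ne_zero_iff.2 h
      exact ⟨‖V‖⁻¹ • V, by simp [norm_smul, h'], by simp [smul_smul, h']⟩
  have ho : Orthonormal ℝ (({0} : Set (Fin 3)).domRestrict fun _ => e) :=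
    ⟨by simp [he], fun i j hij => (hij (Subsingleton.elim _ _)).elim⟩
  obtain ⟨b, hb⟩ := ho.exists_orthonormalBasis_extension_of_card_eq (by simp)
  refine ⟨fun x => b.repr.symm (WithLp.toLp 2 x),
    b.measurePreserving_repr_symm.comp (PiLp.volume_preserving_toLp (Fin 3)), fun x => ?_,
    fun x => ?_⟩
  · rw [LinearIsometryEquiv.norm_map, EuclideanSpace.real_norm_sq_eq, Fin.sum_univ_three]
  · conv_lhs => rw [hV, ← hb 0 rfl]
    rw [real_inner_smul_left, ← b.repr_apply_apply, LinearIsometryEquiv.apply_symm_apply]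

lemma weighted_kernel_le_prod (β : ℝ) (V u : EuclideanSpace ℝ (Fin 3)) {x y z : ℝ}
    (hy : y ≠ 0) (hz : z ≠ 0) (hu : ‖u‖ ^ 2 = x ^ 2 + y ^ 2 + z ^ 2) (hVu : ⟪V, u⟫ = ‖V‖ * x) :
    (‖u‖ + ‖u‖⁻¹) *
        exp (-(1 / 8) * ‖u‖ ^ 2 - (1 / 8) * ((‖V‖ ^ 2 - ‖V + u‖ ^ 2) ^ 2 / ‖u‖ ^ 2)) *
        ((1 + ‖V‖ ^ 2) ^ β * (1 + ‖V + u‖ ^ 2) ^ (-β)) ≤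
      2 ^ |β| * (64 * (|β| + 1)) ^ (|β| + 1) * exp (3 / 32) *
        (exp (-(1 / 16) * |(1 + ‖V‖) * x|) * (|y| ^ (-1 / 2 : ℝ) * exp (-(1 / 16) * |y|)) *
          (|z| ^ (-1 / 2 : ℝ) * exp (-(1 / 16) * |z|))) := by
  have hr : 0 < ‖u‖ := by
    refine (norm_nonneg u).lt_of_ne' fun h => ?_
    have := pow_pos (abs_pos.2 hy) 2
    rw [sq_abs] at this
    rw [h] at hu
    nlinarith [sq_nonneg x, sq_nonneg z]
  have hB : ‖V‖ ^ 2 - ‖V + u‖ ^ 2 = -(2 * (‖V‖ * x) + ‖u‖ ^ 2) := by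
    rw [norm_add_sq_real, hVu]; ring
  have hw : (1 + ‖V‖ ^ 2) ^ β * (1 + ‖V + u‖ ^ 2) ^ (-β) ≤ (2 * (1 + ‖u‖ ^ 2)) ^ |β| := by
    have h1 : ‖V‖ ≤ ‖V + u‖ + ‖u‖ := by simpa using norm_sub_le (V + u) u
    have h2 := norm_add_le V u
    apply weight_ratio_le
    · positivity
    · positivity
    · nlinarith [sq_nonneg (‖V + u‖ - ‖u‖), mul_nonneg (sq_nonneg ‖V + u‖) (sq_nonneg ‖u‖),
        pow_le_pow_left₀ (norm_nonneg V) h1 2]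
    · nlinarith [sq_nonneg (‖V‖ - ‖u‖), mul_nonneg (sq_nonneg ‖V‖) (sq_nonneg ‖u‖),
        pow_le_pow_left₀ (norm_nonneg (V + u)) h2 2]
  have hE := kernel_exponent_le (norm_nonneg V) hr hu
  have hinv := inv_le_rpow_mul_rpow hr hy hz (by nlinarith [sq_nonneg x])
  have hpow := one_add_rpow_le_exp (n := |β| + 1) (t := ‖u‖ ^ 2) (by simp) (by positivity)
  have hsum : ‖u‖ + ‖u‖⁻¹ = (1 + ‖u‖ ^ 2) * ‖u‖⁻¹ := by field_simp; ring
  rw [hB, neg_sq]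
  set E := -(1 / 8) * ‖u‖ ^ 2 - (1 / 8) * ((2 * (‖V‖ * x) + ‖u‖ ^ 2) ^ 2 / ‖u‖ ^ 2)
  calc (‖u‖ + ‖u‖⁻¹) * exp E * ((1 + ‖V‖ ^ 2) ^ β * (1 + ‖V + u‖ ^ 2) ^ (-β))
      ≤ (‖u‖ + ‖u‖⁻¹) * exp E * (2 * (1 + ‖u‖ ^ 2)) ^ |β| := by gcongr
    _ = 2 ^ |β| * ‖u‖⁻¹ * exp E * (1 + ‖u‖ ^ 2) ^ (|β| + 1) := by
      rw [hsum, mul_rpow (by norm_num) (by positivity), rpow_add_one (by positivity)]; ring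
    _ ≤ 2 ^ |β| * (|y| ^ (-1 / 2 : ℝ) * |z| ^ (-1 / 2 : ℝ)) * exp E *
          ((64 * (|β| + 1)) ^ (|β| + 1) * exp (‖u‖ ^ 2 / 64)) := by gcongr
    _ = 2 ^ |β| * (64 * (|β| + 1)) ^ (|β| + 1) * (|y| ^ (-1 / 2 : ℝ) * |z| ^ (-1 / 2 : ℝ)) *
          exp (E + ‖u‖ ^ 2 / 64) := by rw [exp_add]; ring
    _ ≤ 2 ^ |β| * (64 * (|β| + 1)) ^ (|β| + 1) * (|y| ^ (-1 / 2 : ℝ) * |z| ^ (-1 / 2 : ℝ)) *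
          exp (3 / 32 - (1 / 16) * |(1 + ‖V‖) * x| - (1 / 16) * |y| - (1 / 16) * |z|) := by
      gcongr
    _ = _ := by
      simp only [sub_eq_add_neg, exp_add, neg_mul]; ring

lemma lintegral_prod_exp_neg_abs {K R : ℝ} (hK : 0 ≤ K) (hR : 0 ≤ R) :
    ∫⁻ x : Fin 3 → ℝ, ENNReal.ofReal (K *
        (exp (-(1 / 16) * |(1 + R) * x 0|) * (|x 1| ^ (-1 / 2 : ℝ) * exp (-(1 / 16) * |x 1|)) *
          (|x 2| ^ (-1 / 2 : ℝ) * exp (-(1 / 16) * |x 2|)))) =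
      ENNReal.ofReal (K * (∫ t : ℝ, exp (-(1 / 16) * |t|)) *
        (∫ t : ℝ, |t| ^ (-1 / 2 : ℝ) * exp (-(1 / 16) * |t|)) ^ 2 / (1 + R)) := by
  have h0 : Integrable fun t : ℝ => exp (-(1 / 16) * |t|) := by
    simpa using integrable_abs_rpow_mul_exp_neg (s := 0) (by norm_num)
  have h1 := integrable_abs_rpow_mul_exp_neg (s := -1 / 2) (by norm_num)
  let f : Fin 3 → ℝ → ℝ := ![fun t => exp (-(1 / 16) * |(1 + R) * t|),
    fun t => |t| ^ (-1 / 2 : ℝ) * exp (-(1 / 16) * |t|),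
    fun t => |t| ^ (-1 / 2 : ℝ) * exp (-(1 / 16) * |t|)]
  have hf : ∀ i, Integrable (f i) := by
    intro i
    fin_cases i
    · exact h0.comp_mul_left' (by positivity : 1 + R ≠ 0)
    · exact h1
    · exact h1
  have hprod := Integrable.fintype_prod hf
  have hint := integral_fintype_prod_volume_eq_prod f
  simp only [Fin.prod_univ_three, f, Matrix.cons_val, ← volume_pi] at hprod hint
  rw [← ofReal_integral_eq_lintegral_ofReal (hprod.const_mul K)
    (ae_of_all _ fun x => by positivity), integral_const_mul, hint,
    Measure.integral_comp_mul_left (fun t => exp (-(1 / 16) * |t|)), abs_of_pos (by positivity)]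
  congr 1
  simp only [smul_eq_mul]
  ring

theorem weighted_grad_kernel_integral_bound (β : ℝ) :
    ∃ C > (0 : ℝ), ∀ a v : EuclideanSpace ℝ (Fin 3),
      ∫⁻ v' : EuclideanSpace ℝ (Fin 3),
          ENNReal.ofReal
            ((‖v - v'‖ + ‖v - v'‖⁻¹) *
              Real.exp (-(1 / 8) * ‖v - v'‖ ^ 2
                - (1 / 8) * ((‖v - a‖ ^ 2 - ‖v' - a‖ ^ 2) ^ 2 / ‖v - v'‖ ^ 2)) *
              ((1 + ‖v - a‖ ^ 2) ^ β * (1 + ‖v' - a‖ ^ 2) ^ (-β)))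
        ≤ ENNReal.ofReal (C / (1 + ‖v - a‖)) := by
  set K : ℝ := 2 ^ |β| * (64 * (|β| + 1)) ^ (|β| + 1) * exp (3 / 32)
  have hK : 0 ≤ K := by positivity
  set I : ℝ := K * (∫ t : ℝ, exp (-(1 / 16) * |t|)) *
    (∫ t : ℝ, |t| ^ (-1 / 2 : ℝ) * exp (-(1 / 16) * |t|)) ^ 2
  have hI : 0 ≤ I :=
    mul_nonneg (mul_nonneg hK (integral_nonneg fun t => (exp_pos _).le)) (sq_nonneg _)
  refine ⟨I + 1, by positivity, fun a v => ?_⟩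
  obtain ⟨T, hT, hTnorm, hTinner⟩ := exists_measurePreserving_adapted_coordinates (v - a)
  rw [← lintegral_add_left_eq_self _ v, ← hT.lintegral_comp (by fun_prop)]
  refine (lintegral_mono_ae (g := fun x : Fin 3 → ℝ => ENNReal.ofReal (K *
    (exp (-(1 / 16) * |(1 + ‖v - a‖) * x 0|) *
      (|x 1| ^ (-1 / 2 : ℝ) * exp (-(1 / 16) * |x 1|)) *
      (|x 2| ^ (-1 / 2 : ℝ) * exp (-(1 / 16) * |x 2|))))) ?_).trans ?_
  · filter_upwards [Measure.ae_eval_ne (fun _ : Fin 3 => (volume : Measure ℝ)) 1 0,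
      Measure.ae_eval_ne (fun _ : Fin 3 => (volume : Measure ℝ)) 2 0] with x h1 h2
    have h := weighted_kernel_le_prod β (v - a) (T x) h1 h2 (hTnorm x) (hTinner x)
    have e1 : ‖v - (v + T x)‖ = ‖T x‖ := by simp
    have e2 : v + T x - a = v - a + T x := by abel
    rw [e1, e2]
    exact ENNReal.ofReal_le_ofReal h
  · rw [lintegral_prod_exp_neg_abs hK (norm_nonneg _)]
    gcongr
    exact le_add_of_nonneg_right zero_le_one
end
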